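/- Let X be a compact metric space, f : X → X continuous, and φ : X → ℝ continuous. If there is a real number λ with ∫ φ dμ = λ for every f-invariant Borel probability measure μ, then the Birkhoff averages (1/n) · Σ_{i=0}^{n-1} φ(f^i(x)) converge to λ uniformly in x ∈ X as n → ∞; that is, for every ε > 0 there exists N such that |(1/n) · Σ_{i=0}^{n-1} φ(f^i(x)) − λ| < ε for all n ≥ N and all x ∈ X. -/

import Mathlib

open MeasureTheory

open Filter Topology
open scoped ENNReal BoundedContinuousFunction

/-- The uniform probability measure on the orbit segment `x, f x, …, f^[n - 1] x`. -/
noncomputable def empiricalMeasure {X : Type*} [MeasurableSpace X] (f : X → X) (n : ℕ) (x : X) :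
    Measure X :=
  (n : ℝ≥0∞)⁻¹ • ∑ i ∈ Finset.range n, Measure.dirac (f^[i] x)

theorem isProbabilityMeasure_empiricalMeasure {X : Type*} [MeasurableSpace X] (f : X → X) {n : ℕ}
    (hn : n ≠ 0) (x : X) : IsProbabilityMeasure (empiricalMeasure f n x) := by
  refine ⟨?_⟩
  simp only [empiricalMeasure, Measure.smul_apply, Measure.finsetSum_apply, measure_univ,
    Finset.sum_const, Finset.card_range, nsmul_eq_mul, mul_one, smul_eq_mul]
  exact ENNReal.inv_mul_cancel (by exact_mod_cast hn) (ENNReal.natCast_ne_top n)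

theorem integral_empiricalMeasure {X : Type*} [MeasurableSpace X] (f : X → X) (n : ℕ) (x : X)
    {g : X → ℝ} (hg : StronglyMeasurable g) :
    ∫ y, g y ∂empiricalMeasure f n x = birkhoffAverage ℝ f g n x := by
  rw [empiricalMeasure, integral_smul_measure, integral_finsetSum_measure]
  · simp [integral_dirac' _ _ hg, birkhoffAverage, birkhoffSum]
  · exact fun i _ ↦ integrable_dirac' hg (by simp)

/-- A limit of empirical measures along orbit segments of length tending to infinity is
invariant. -/
theorem map_eq_of_tendsto_birkhoffAverage {X ι : Type*} [PseudoMetricSpace X] [MeasurableSpace X]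
    [BorelSpace X] {f : X → X} (hf : Continuous f) {μ : Measure X} [IsProbabilityMeasure μ]
    {l : Filter ι} [l.NeBot] {n : ι → ℕ} (hn : Tendsto n l atTop) (x : ι → X)
    (hμ : ∀ g : X →ᵇ ℝ, Tendsto (fun k ↦ birkhoffAverage ℝ f g (n k) (x k)) l
      (𝓝 (∫ y, g y ∂μ))) :
    μ.map f = μ := by
  have : IsProbabilityMeasure (μ.map f) := Measure.isProbabilityMeasure_map hf.aemeasurable
  refine ext_of_forall_integral_eq_of_IsFiniteMeasure fun g ↦ ?_
  rw [integral_map hf.aemeasurable g.continuous.aestronglyMeasurable]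
  have hcomp : Tendsto (fun k ↦ birkhoffAverage ℝ f g (n k) (f (x k))) l
      (𝓝 (∫ y, g (f y) ∂μ)) := by
    refine (hμ (g.compContinuous ⟨f, hf⟩)).congr fun k ↦ ?_
    simp [birkhoffAverage, birkhoffSum, ← Function.iterate_succ_apply, Function.iterate_succ_apply']
  have hdiff : Tendsto (fun k ↦ birkhoffAverage ℝ f g (n k) (f (x k)) -
      birkhoffAverage ℝ f g (n k) (x k)) l (𝓝 0) := by
    refine squeeze_zero_norm (fun k ↦ ?_)
      ((tendsto_const_div_atTop_nhds_zero_nat (2 * ‖g‖)).comp hn)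
    rw [← dist_eq_norm, dist_birkhoffAverage_apply_birkhoffAverage]
    exact div_le_div_of_nonneg_right (g.dist_le_two_norm _ _) (Nat.cast_nonneg _)
  exact sub_eq_zero.1 (tendsto_nhds_unique (hcomp.sub (hμ g)) hdiff)

/-- If the integral of a continuous function `φ` equals `λ` for every
`f`-invariant Borel probability measure on a compact metric space, then the
Birkhoff averages of `φ` converge to `λ` uniformly on `X`. -/
theorem stmt_4 {X : Type*} [MetricSpace X] [CompactSpace X]
    [MeasurableSpace X] [BorelSpace X]
    (f : X → X) (hf : Continuous f) (φ : X → ℝ) (hφ : Continuous φ) (lam : ℝ)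
    (h : ∀ μ : Measure X, IsProbabilityMeasure μ → Measure.map f μ = μ →
      ∫ x, φ x ∂μ = lam) :
    ∀ ε > 0, ∃ N : ℕ, 0 < N ∧ ∀ n ≥ N, ∀ x : X,
      |(1 / (n : ℝ)) * ∑ i ∈ Finset.range n, φ (f^[i] x) - lam| < ε := by
  intro ε hε
  by_contra! hcon
  choose n hn x hx using fun k : ℕ ↦ hcon (k + 1) k.succ_pos
  let l : Ultrafilter ℕ := hyperfilter ℕ
  have hl : (l : Filter ℕ) ≤ atTop := Nat.hyperfilter_le_atTop
  have hn_atTop : Tendsto n l atTop :=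
    (tendsto_atTop_mono (fun k ↦ k.le_succ.trans (hn k)) tendsto_id).mono_left hl
  let ν : ℕ → ProbabilityMeasure X := fun k ↦
    ⟨empiricalMeasure f (n k) (x k),
      isProbabilityMeasure_empiricalMeasure f (k.succ_pos.trans_le (hn k)).ne' (x k)⟩
  obtain ⟨μ, -, hμ⟩ := isCompact_univ.ultrafilter_le_nhds (l.map ν) (by simp)
  have hlim (g : X →ᵇ ℝ) : Tendsto (fun k ↦ birkhoffAverage ℝ f g (n k) (x k)) l
      (𝓝 (∫ y, g y ∂(μ : Measure X))) := by
    refine ((ProbabilityMeasure.tendsto_iff_forall_integral_tendsto (μs := ν)).1 hμ g).congr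
      fun k ↦ ?_
    exact integral_empiricalMeasure f (n k) (x k) g.continuous.stronglyMeasurable
  have hφlim := hlim (BoundedContinuousFunction.mkOfCompact ⟨φ, hφ⟩)
  have hint : ∫ y, φ y ∂(μ : Measure X) = lam :=
    h μ inferInstance (map_eq_of_tendsto_birkhoffAverage hf hn_atTop x hlim)
  have hdist := ge_of_tendsto (hφlim.sub_const lam).abs <| Eventually.of_forall fun k ↦ by
    simpa [birkhoffAverage, birkhoffSum] using hx k
  simp only [BoundedContinuousFunction.mkOfCompact_apply, ContinuousMap.coe_mk, hint, sub_self,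
    abs_zero] at hdist
  exact hε.not_ge hdist
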